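/- One has the continued fraction identity [4; overline{4}] + [0; 3, overline{1,3,1,2}] = 9/2 = [3; 1, 3, overline{4}] + [0; overline{1,2,1,3}]. Consequently 9/2 = m(overline{4} 3 overline{1,3,1,2}), where overline{4} 3 overline{1,3,1,2} is the bi-infinite sequence consisting of 4's at all negative positions, a single 3, and then periodic repetition of 1,3,1,2; moreover 9/2 = lim_{n→∞} m(overline{4ⁿ 3 (1312)ⁿ 1313}) where overline{4ⁿ 3 (1312)ⁿ 1313} is the bi-infinite periodic sequence with period 4ⁿ 3 (1312)ⁿ 1313, and therefore 9/2 belongs to L ∩ ℚ, where L is the Lagrange spectrum. -/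

import Mathlib

open Filter

/-- Numerators of the convergents of the continued fraction `[a 0; a 1, a 2, …]`. -/
def cfNum (a : ℕ → ℕ) : ℕ → ℕ
  | 0 => a 0
  | 1 => a 1 * a 0 + 1
  | n + 2 => a (n + 2) * cfNum a (n + 1) + cfNum a n

/-- Denominators of the convergents of the continued fraction `[a 0; a 1, a 2, …]`. -/
def cfDen (a : ℕ → ℕ) : ℕ → ℕ
  | 0 => 1
  | 1 => a 1
  | n + 2 => a (n + 2) * cfDen a (n + 1) + cfDen a n

/-- Value of the infinite continued fraction `[a 0; a 1, a 2, …]` (the limit of its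
convergents). -/
noncomputable def cfVal (a : ℕ → ℕ) : ℝ :=
  limUnder atTop fun n => (cfNum a n : ℝ) / (cfDen a n)

/-- Value of the infinite continued fraction `[0; a 0, a 1, …]`. -/
noncomputable def cf01 (a : ℕ → ℕ) : ℝ := 1 / cfVal a

/-- `λ₀(α) = [α 0; α 1, α 2, …] + [0; α (-1), α (-2), …]`. -/
noncomputable def lambda0 (α : ℤ → ℕ) : ℝ :=
  cfVal (fun n : ℕ => α (n : ℤ)) + cf01 (fun n : ℕ => α (-((n : ℤ) + 1)))

/-- The shift `σ^N` on bi-infinite sequences. -/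
def shiftZ (N : ℤ) (α : ℤ → ℕ) : ℤ → ℕ := fun i => α (i + N)

/-- The Markov value `m(α) = sup_{n ∈ ℤ} λ₀(σⁿ α)`. -/
noncomputable def markovValue (α : ℤ → ℕ) : ℝ := ⨆ n : ℤ, lambda0 (shiftZ n α)

/-- The Lagrange value `ℓ(α) = limsup_{n → +∞} λ₀(σⁿ α)`. -/
noncomputable def lagrangeValue (α : ℤ → ℕ) : ℝ :=
  limsup (fun n : ℕ => lambda0 (shiftZ (n : ℤ) α)) atTop

/-- The Markov spectrum `M`. -/
def MarkovSpectrum : Set ℝ :=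
  { x | ∃ α : ℤ → ℕ, (∀ i, 1 ≤ α i) ∧ markovValue α = x }

/-- The Lagrange spectrum `L`. -/
def LagrangeSpectrum : Set ℝ :=
  { x | ∃ α : ℤ → ℕ, (∀ i, 1 ≤ α i) ∧ lagrangeValue α = x }

/-- The periodic sequence `overline{1,3,1,2}`. -/
def pat1312 : ℕ → ℕ := fun n => [1, 3, 1, 2].getD (n % 4) 0

/-- The partial quotients of `[0; 3, overline{1,3,1,2}]`. -/
def seq3then1312 : ℕ → ℕ := fun n => if n = 0 then 3 else pat1312 (n - 1)

/-- The partial quotients of `[3; 1, 3, overline{4}]`. -/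
def seq313bar4 : ℕ → ℕ := fun n => [3, 1, 3].getD n 4

/-- The periodic sequence `overline{1,2,1,3}`. -/
def pat1213 : ℕ → ℕ := fun n => [1, 2, 1, 3].getD (n % 4) 0

/-- The bi-infinite sequence `overline{4} 3 overline{1,3,1,2}`: `4`'s at all negative
positions, a single `3` at position `0`, and the periodic repetition of `1,3,1,2` at the
positive positions. -/
def bar4_3_bar1312 : ℤ → ℕ := fun i =>
  if i < 0 then 4 else if i = 0 then 3 else [1, 3, 1, 2].getD ((i - 1) % 4).toNat 0

/-- The word `4ⁿ 3 (1312)ⁿ 1313`. -/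
def periodWord (n : ℕ) : List ℕ :=
  List.replicate n 4 ++ [3] ++
    ((List.range (4 * n)).map fun i => [1, 3, 1, 2].getD (i % 4) 0) ++ [1, 3, 1, 3]

/-- The bi-infinite periodic sequence with period the word `w`. -/
def periodicSeqZ (w : List ℕ) : ℤ → ℕ := fun i => w.getD (i % (w.length : ℤ)).toNat 0

/-! ### Convergence of continued fractions -/

theorem cfNum_cfDen_succ (a : ℕ → ℕ) (n : ℕ) :
    cfNum a (n + 1) = a 0 * cfNum (fun i => a (i + 1)) n + cfDen (fun i => a (i + 1)) n ∧
      cfDen a (n + 1) = cfNum (fun i => a (i + 1)) n := by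
  induction n using Nat.twoStepInduction with
  | zero => simp [cfNum, cfDen, mul_comm]
  | one =>
    simp only [cfNum, cfDen]
    exact ⟨by ring, trivial⟩
  | more n ih₁ ih₂ =>
    constructor
    · rw [cfNum, ih₁.1, ih₂.1, cfNum, cfDen]
      ring
    · rw [cfDen, ih₁.2, ih₂.2, cfNum]

theorem cfNum_cfDen_pos {a : ℕ → ℕ} (ha : ∀ i, 1 ≤ a i) (n : ℕ) :
    0 < cfNum a n ∧ 0 < cfDen a n := by
  induction n using Nat.twoStepInduction with
  | zero => exact ⟨ha 0, Nat.one_pos⟩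
  | one => exact ⟨Nat.succ_pos _, ha 1⟩
  | more n ih₁ ih₂ =>
    exact ⟨Nat.add_pos_right _ ih₁.1, Nat.add_pos_right _ ih₁.2⟩

/-- The convergents of `[a 0; a 1, a 2, …]`. -/
noncomputable def cfConv (a : ℕ → ℕ) (n : ℕ) : ℝ := (cfNum a n : ℝ) / (cfDen a n)

theorem cfConv_pos {a : ℕ → ℕ} (ha : ∀ i, 1 ≤ a i) (n : ℕ) : 0 < cfConv a n := by
  have h := cfNum_cfDen_pos ha n
  exact div_pos (mod_cast h.1) (mod_cast h.2)

theorem cfConv_succ {a : ℕ → ℕ} (ha : ∀ i, 1 ≤ a i) (n : ℕ) :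
    cfConv a (n + 1) = a 0 + 1 / cfConv (fun i => a (i + 1)) n := by
  have h : (0 : ℝ) < cfNum (fun i => a (i + 1)) n :=
    mod_cast (cfNum_cfDen_pos (fun i => ha (i + 1)) n).1
  rw [cfConv, cfConv, (cfNum_cfDen_succ a n).1, (cfNum_cfDen_succ a n).2, one_div_div]
  push_cast
  field_simp

theorem le_cfConv {a : ℕ → ℕ} (ha : ∀ i, 1 ≤ a i) (n : ℕ) : (a 0 : ℝ) ≤ cfConv a n := by
  cases n with
  | zero => simp [cfConv, cfNum, cfDen]
  | succ n =>
    rw [cfConv_succ ha]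
    have := cfConv_pos (fun i => ha (i + 1)) n
    have : 0 < 1 / cfConv (fun i => a (i + 1)) n := by positivity
    linarith

theorem one_le_cfConv {a : ℕ → ℕ} (ha : ∀ i, 1 ≤ a i) (n : ℕ) : 1 ≤ cfConv a n :=
  le_trans (mod_cast ha 0) (le_cfConv ha n)

theorem cfConv_le {a : ℕ → ℕ} (ha : ∀ i, 1 ≤ a i) (n : ℕ) : cfConv a n ≤ a 0 + 1 := by
  cases n with
  | zero => simp [cfConv, cfNum, cfDen]
  | succ n =>
    rw [cfConv_succ ha]
    have h := one_le_cfConv (fun i => ha (i + 1)) n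
    have : 1 / cfConv (fun i => a (i + 1)) n ≤ 1 := by
      rw [div_le_one (by linarith)]
      exact h
    linarith

theorem abs_two_step_sub_le {p q s t : ℝ} (hq : 1 ≤ q) (hs : 1 ≤ s) (ht : 1 ≤ t) :
    |(p + 1 / (q + 1 / s)) - (p + 1 / (q + 1 / t))| ≤ |s - t| / 4 := by
  have hqs : 2 ≤ q * s + 1 := by nlinarith
  have hqt : 2 ≤ q * t + 1 := by nlinarith
  have h : (p + 1 / (q + 1 / s)) - (p + 1 / (q + 1 / t))
      = (s - t) / ((q * s + 1) * (q * t + 1)) := by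
    have : q * s + 1 ≠ 0 := by positivity
    have : q * t + 1 ≠ 0 := by positivity
    field_simp
    ring
  rw [h, abs_div, abs_of_pos (show 0 < (q * s + 1) * (q * t + 1) by positivity)]
  exact div_le_div_of_nonneg_left (abs_nonneg _) (by norm_num) (by nlinarith)

theorem abs_cfConv_sub_le (k : ℕ) {a b : ℕ → ℕ} (ha : ∀ i, 1 ≤ a i) (hb : ∀ i, 1 ≤ b i)
    (hab : ∀ i ≤ 2 * k, a i = b i) {m n : ℕ} (hm : 2 * k ≤ m) (hn : 2 * k ≤ n) :
    |cfConv a m - cfConv b n| ≤ (1 / 4) ^ k := by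
  induction k generalizing a b m n with
  | zero =>
    have h₁ := le_cfConv ha m
    have h₂ := cfConv_le ha m
    have h₃ := le_cfConv hb n
    have h₄ := cfConv_le hb n
    rw [← hab 0 le_rfl] at h₃ h₄
    rw [pow_zero, abs_le]
    constructor <;> linarith
  | succ k ih =>
    obtain ⟨m, rfl⟩ : ∃ m', m = m' + 1 + 1 := ⟨m - 2, by omega⟩
    obtain ⟨n, rfl⟩ : ∃ n', n = n' + 1 + 1 := ⟨n - 2, by omega⟩
    have ha₁ : ∀ i, 1 ≤ a (i + 1) := fun i => ha _
    have hb₁ : ∀ i, 1 ≤ b (i + 1) := fun i => hb _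
    rw [cfConv_succ ha, cfConv_succ ha₁, cfConv_succ hb, cfConv_succ hb₁, ← hab 0 (by omega),
      ← hab (0 + 1) (by omega)]
    refine (abs_two_step_sub_le (mod_cast ha _) (one_le_cfConv (fun i => ha _) m)
      (one_le_cfConv (fun i => hb _) n)).trans ?_
    have := ih (a := fun i => a (i + 1 + 1)) (b := fun i => b (i + 1 + 1)) (fun i => ha _)
      (fun i => hb _) (fun i hi => hab _ (by omega)) (m := m) (n := n) (by omega) (by omega)
    rw [pow_succ]
    linarith

theorem tendsto_cfConv {a : ℕ → ℕ} (ha : ∀ i, 1 ≤ a i) :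
    Tendsto (cfConv a) atTop (nhds (cfVal a)) := by
  refine CauchySeq.tendsto_limUnder (u := cfConv a) (Metric.cauchySeq_iff.2 fun ε hε => ?_)
  obtain ⟨k, hk⟩ := exists_pow_lt_of_lt_one hε (show (1 / 4 : ℝ) < 1 by norm_num)
  exact ⟨2 * k, fun m hm n hn =>
    (abs_cfConv_sub_le k ha ha (fun _ _ => rfl) hm hn).trans_lt hk⟩

theorem le_cfVal {a : ℕ → ℕ} (ha : ∀ i, 1 ≤ a i) : (a 0 : ℝ) ≤ cfVal a :=
  ge_of_tendsto' (tendsto_cfConv ha) (le_cfConv ha)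

theorem one_le_cfVal {a : ℕ → ℕ} (ha : ∀ i, 1 ≤ a i) : 1 ≤ cfVal a :=
  ge_of_tendsto' (tendsto_cfConv ha) (one_le_cfConv ha)

theorem cfVal_succ {a : ℕ → ℕ} (ha : ∀ i, 1 ≤ a i) :
    cfVal a = a 0 + 1 / cfVal (fun i => a (i + 1)) := by
  have ha₁ : ∀ i, 1 ≤ a (i + 1) := fun i => ha _
  have h₁ := (tendsto_cfConv ha).comp (tendsto_add_atTop_nat 1)
  have h₂ : Tendsto (fun n => (a 0 : ℝ) + 1 / cfConv (fun i => a (i + 1)) n) atTop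
      (nhds (a 0 + 1 / cfVal (fun i => a (i + 1)))) :=
    ((tendsto_const_nhds).div (tendsto_cfConv ha₁)
      (by linarith [one_le_cfVal ha₁])).const_add _
  refine tendsto_nhds_unique h₁ (h₂.congr fun n => ?_)
  exact (cfConv_succ ha n).symm

theorem abs_cfVal_sub_le (k : ℕ) {a b : ℕ → ℕ} (ha : ∀ i, 1 ≤ a i) (hb : ∀ i, 1 ≤ b i)
    (hab : ∀ i ≤ 2 * k, a i = b i) : |cfVal a - cfVal b| ≤ (1 / 4) ^ k := by
  refine le_of_tendsto ((tendsto_cfConv ha).sub (tendsto_cfConv hb)).abs ?_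
  filter_upwards [eventually_ge_atTop (2 * k)] with n hn
  exact abs_cfConv_sub_le k ha hb hab hn hn

/-! ### One-sided expansions of a bi-infinite sequence -/

/-- `[α i; α (i + 1), α (i + 2), …]`. -/
noncomputable def cfRight (α : ℤ → ℕ) (i : ℤ) : ℝ := cfVal fun n : ℕ => α (i + n)

/-- `[α i; α (i - 1), α (i - 2), …]`. -/
noncomputable def cfLeft (α : ℤ → ℕ) (i : ℤ) : ℝ := cfVal fun n : ℕ => α (i - n)

section Bilateral

variable {α : ℤ → ℕ}

theorem cfRight_eq (hα : ∀ i, 1 ≤ α i) (i : ℤ) :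
    cfRight α i = α i + 1 / cfRight α (i + 1) := by
  rw [cfRight, cfVal_succ fun n => hα _, cfRight]
  simp [add_left_comm, add_comm]

theorem cfLeft_eq (hα : ∀ i, 1 ≤ α i) (i : ℤ) : cfLeft α i = α i + 1 / cfLeft α (i - 1) := by
  rw [cfLeft, cfVal_succ fun n => hα _, cfLeft]
  simp [sub_sub, add_comm]

theorem le_cfRight (hα : ∀ i, 1 ≤ α i) (i : ℤ) : (α i : ℝ) ≤ cfRight α i := by
  simpa [cfRight] using le_cfVal (a := fun n : ℕ => α (i + n)) fun n => hα _

theorem le_cfLeft (hα : ∀ i, 1 ≤ α i) (i : ℤ) : (α i : ℝ) ≤ cfLeft α i := by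
  simpa [cfLeft] using le_cfVal (a := fun n : ℕ => α (i - n)) fun n => hα _

theorem one_div_cfRight_le (hα : ∀ i, 1 ≤ α i) (i : ℤ) : 1 / cfRight α i ≤ 1 / α i :=
  one_div_le_one_div_of_le (mod_cast hα i) (le_cfRight hα i)

theorem one_div_cfLeft_le (hα : ∀ i, 1 ≤ α i) (i : ℤ) : 1 / cfLeft α i ≤ 1 / α i :=
  one_div_le_one_div_of_le (mod_cast hα i) (le_cfLeft hα i)

theorem one_div_cfRight_le_one (hα : ∀ i, 1 ≤ α i) (i : ℤ) : 1 / cfRight α i ≤ 1 :=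
  div_le_one_of_le₀ ((Nat.one_le_cast.2 (hα i)).trans (le_cfRight hα i))
    ((Nat.cast_nonneg _).trans (le_cfRight hα i))

theorem one_div_cfLeft_le_one (hα : ∀ i, 1 ≤ α i) (i : ℤ) : 1 / cfLeft α i ≤ 1 :=
  div_le_one_of_le₀ ((Nat.one_le_cast.2 (hα i)).trans (le_cfLeft hα i))
    ((Nat.cast_nonneg _).trans (le_cfLeft hα i))

theorem lambda0_shiftZ (hα : ∀ i, 1 ≤ α i) (i : ℤ) :
    lambda0 (shiftZ i α) = α i + 1 / cfRight α (i + 1) + 1 / cfLeft α (i - 1) := by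
  rw [← cfRight_eq hα, cfRight, cfLeft, lambda0, cf01]
  congr 4 <;> (funext n; simp only [shiftZ]; congr 1; ring)

theorem lambda0_shiftZ_nonneg (hα : ∀ i, 1 ≤ α i) (i : ℤ) : 0 ≤ lambda0 (shiftZ i α) := by
  rw [lambda0_shiftZ hα]
  have h₁ := (Nat.cast_nonneg _).trans (le_cfRight hα (i + 1))
  have h₂ := (Nat.cast_nonneg _).trans (le_cfLeft hα (i - 1))
  positivity

theorem lambda0_shiftZ_le (hα : ∀ i, 1 ≤ α i) (i : ℤ) : lambda0 (shiftZ i α) ≤ α i + 2 := by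
  rw [lambda0_shiftZ hα]
  linarith [one_div_cfRight_le_one hα (i + 1), one_div_cfLeft_le_one hα (i - 1)]

theorem lambda0_shiftZ_comp_neg (hα : ∀ i, 1 ≤ α i) (i : ℤ) :
    lambda0 (shiftZ i fun j => α (-j)) = lambda0 (shiftZ (-i) α) := by
  rw [lambda0_shiftZ hα, lambda0_shiftZ fun j => hα (-j)]
  have h₁ : cfRight (fun j => α (-j)) (i + 1) = cfLeft α (-i - 1) := by
    rw [cfRight, cfLeft]; congr 1; funext n; congr 1; ring
  have h₂ : cfLeft (fun j => α (-j)) (i - 1) = cfRight α (-i + 1) := by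
    rw [cfRight, cfLeft]; congr 1; funext n; congr 1; ring
  rw [h₁, h₂]
  ring

theorem abs_one_div_sub_le {x y : ℝ} (hx : 1 ≤ x) (hy : 1 ≤ y) :
    |1 / x - 1 / y| ≤ |x - y| := by
  have h : 1 / x - 1 / y = (y - x) / (x * y) := by
    have : x ≠ 0 := by positivity
    have : y ≠ 0 := by positivity
    field_simp
  rw [h, abs_div, abs_sub_comm, abs_of_pos (show 0 < x * y by positivity)]
  exact div_le_self (abs_nonneg _) (by nlinarith)

theorem exists_radius_abs_lambda0_sub_le {ε : ℝ} (hε : 0 < ε) :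
    ∃ R : ℤ, 0 ≤ R ∧ ∀ α β : ℤ → ℕ, (∀ i, 1 ≤ α i) → (∀ i, 1 ≤ β i) → ∀ i c : ℤ,
      (∀ j, |j| ≤ R → α (i + j) = β (c + j)) →
      |lambda0 (shiftZ i α) - lambda0 (shiftZ c β)| ≤ ε := by
  obtain ⟨k, hk⟩ := exists_pow_lt_of_lt_one (half_pos hε) (show (1 / 4 : ℝ) < 1 by norm_num)
  refine ⟨2 * k + 1, by positivity, fun α β hα hβ i c h => ?_⟩
  have h₀ : α i = β c := by simpa using h 0 (by rw [abs_zero]; positivity)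
  rw [lambda0_shiftZ hα, lambda0_shiftZ hβ, h₀]
  have hr : |cfRight α (i + 1) - cfRight β (c + 1)| ≤ (1 / 4) ^ k :=
    abs_cfVal_sub_le k (fun _ => hα _) (fun _ => hβ _) fun n hn => by
      rw [add_assoc, add_assoc]
      exact h _ (by rw [abs_le]; omega)
  have hl : |cfLeft α (i - 1) - cfLeft β (c - 1)| ≤ (1 / 4) ^ k :=
    abs_cfVal_sub_le k (fun _ => hα _) (fun _ => hβ _) fun n hn => by
      rw [sub_sub, sub_sub]
      exact h (-(1 + n)) (by rw [abs_le]; omega)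
  have hr' := (abs_one_div_sub_le (one_le_cfVal fun n => hα (i + 1 + n))
    (one_le_cfVal fun n => hβ (c + 1 + n))).trans hr
  have hl' := (abs_one_div_sub_le (one_le_cfVal fun n => hα (i - 1 - n))
    (one_le_cfVal fun n => hβ (c - 1 - n))).trans hl
  rw [← cfRight, ← cfRight, abs_le] at hr'
  rw [← cfLeft, ← cfLeft, abs_le] at hl'
  rw [abs_le]
  constructor <;> linarith [hr'.1, hr'.2, hl'.1, hl'.2]

end Bilateral

/-! ### The continued fraction identities -/

theorem cfVal_four : cfVal (fun _ => 4) = 2 + √5 := by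
  have h := cfVal_succ (a := fun _ => 4) (fun _ => by norm_num)
  have h₁ := one_le_cfVal (a := fun _ => 4) (fun _ => by norm_num)
  set x := cfVal (fun _ => 4)
  push_cast at h
  have hx : (x - 2) ^ 2 = 5 := by field_simp at h; linarith
  have h₂ : 4 ≤ x := by
    have : 0 < 1 / x := by positivity
    linarith
  rw [← hx, Real.sqrt_sq (by linarith)]
  ring

theorem getD_mod_four_pos {a b c d : ℕ} (ha : 1 ≤ a) (hb : 1 ≤ b) (hc : 1 ≤ c) (hd : 1 ≤ d)
    {m : ℕ} (hm : m < 4) : 1 ≤ [a, b, c, d].getD m 0 := by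
  interval_cases m <;> simpa

theorem one_le_pat1312 (n : ℕ) : 1 ≤ pat1312 n :=
  getD_mod_four_pos (by norm_num) (by norm_num) (by norm_num) (by norm_num)
    (Nat.mod_lt _ (by norm_num))

theorem one_le_pat1213 (n : ℕ) : 1 ≤ pat1213 n :=
  getD_mod_four_pos (by norm_num) (by norm_num) (by norm_num) (by norm_num)
    (Nat.mod_lt _ (by norm_num))

theorem cfVal_four_step {a : ℕ → ℕ} (ha : ∀ i, 1 ≤ a i) :
    cfVal a = a 0 + 1 / (a 1 + 1 / (a 2 + 1 / (a 3 + 1 / cfVal (fun i => a (i + 4))))) := by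
  rw [cfVal_succ ha, cfVal_succ fun i => ha (i + 1), cfVal_succ fun i => ha (i + 1 + 1),
    cfVal_succ fun i => ha (i + 1 + 1 + 1)]

theorem one_div_cfVal_pat1312 : 1 / cfVal pat1312 = 4 * √5 / 5 - 1 := by
  have h := cfVal_four_step one_le_pat1312
  have h₁ := one_le_cfVal one_le_pat1312
  have hp : (fun i => pat1312 (i + 4)) = pat1312 := by
    funext i
    simp [pat1312]
  rw [hp] at h
  set y := cfVal pat1312
  simp only [pat1312] at h
  norm_num at h
  have hx : (5 * (1 / y + 1) / 4) ^ 2 = 5 := by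
    field_simp at h ⊢
    linarith
  have : √5 = 5 * (1 / y + 1) / 4 :=
    (Real.sqrt_eq_iff_mul_self_eq (by norm_num) (by positivity)).2 (by rw [← sq, hx])
  linarith

theorem one_div_cfVal_pat1213 : 1 / cfVal pat1213 = √5 - 3 / 2 := by
  have h := cfVal_four_step one_le_pat1213
  have h₁ := one_le_cfVal one_le_pat1213
  have hp : (fun i => pat1213 (i + 4)) = pat1213 := by
    funext i
    simp [pat1213]
  rw [hp] at h
  set y := cfVal pat1213
  simp only [pat1213] at h
  norm_num at h
  have hx : (1 / y + 3 / 2) ^ 2 = 5 := by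
    field_simp at h ⊢
    linarith
  have : √5 = 1 / y + 3 / 2 :=
    (Real.sqrt_eq_iff_mul_self_eq (by norm_num) (by positivity)).2 (by rw [← sq, hx])
  linarith

theorem cfVal_four_add_cf01_seq3then1312 : cfVal (fun _ => 4) + cf01 seq3then1312 = 9 / 2 := by
  have h : cfVal seq3then1312 = 3 + 1 / cfVal pat1312 := by
    rw [cfVal_succ]
    · simp [seq3then1312]
    · intro i
      unfold seq3then1312
      split_ifs
      · norm_num
      · exact one_le_pat1312 _
  rw [cf01, h, one_div_cfVal_pat1312, cfVal_four]
  have hs : √5 ^ 2 = 5 := Real.sq_sqrt (by norm_num)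
  have hpos : (0 : ℝ) < 3 + (4 * √5 / 5 - 1) := by
    have := Real.sqrt_nonneg 5
    linarith
  have : 1 / (3 + (4 * √5 / 5 - 1)) = 5 / 2 - √5 := by
    rw [div_eq_iff hpos.ne']
    linarith
  linarith

theorem cfVal_seq313bar4_add_cf01_pat1213 : cfVal seq313bar4 + cf01 pat1213 = 9 / 2 := by
  have hpos : ∀ i, 1 ≤ seq313bar4 i := by
    intro i
    rcases i with _ | _ | _ | i <;> simp [seq313bar4]
  have h : cfVal seq313bar4 = 3 + 1 / (1 + 1 / (3 + 1 / cfVal (fun _ => 4))) := by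
    rw [cfVal_succ hpos, cfVal_succ fun i => hpos (i + 1), cfVal_succ fun i => hpos (i + 1 + 1)]
    simp [seq313bar4]
  rw [cf01, h, one_div_cfVal_pat1213, cfVal_four]
  have hs : √5 ^ 2 = 5 := Real.sq_sqrt (by norm_num)
  field_simp
  linarith

/-! ### The sequence `overline{4} 3 overline{1,3,1,2}` -/

theorem bar_of_neg {i : ℤ} (hi : i < 0) : bar4_3_bar1312 i = 4 := if_pos hi

theorem bar_zero : bar4_3_bar1312 0 = 3 := rfl

theorem bar_of_pos {i : ℤ} (hi : 0 < i) :
    bar4_3_bar1312 i = [2, 1, 3, 1].getD (i % 4).toNat 0 := by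
  rw [bar4_3_bar1312, if_neg (by omega), if_neg (by omega)]
  have h : i % 4 = 0 ∨ i % 4 = 1 ∨ i % 4 = 2 ∨ i % 4 = 3 := by omega
  rcases h with h | h | h | h
  · rw [h, show (i - 1) % 4 = 3 by omega]; rfl
  · rw [h, show (i - 1) % 4 = 0 by omega]; rfl
  · rw [h, show (i - 1) % 4 = 1 by omega]; rfl
  · rw [h, show (i - 1) % 4 = 2 by omega]; rfl

theorem one_le_bar (i : ℤ) : 1 ≤ bar4_3_bar1312 i := by
  rcases lt_trichotomy i 0 with hi | rfl | hi
  · simp [bar_of_neg hi]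
  · simp [bar_zero]
  · rw [bar_of_pos hi]
    exact getD_mod_four_pos (by norm_num) (by norm_num) (by norm_num) (by norm_num) (by omega)

theorem lambda0_bar_neg_one : lambda0 (shiftZ (-1) bar4_3_bar1312) = 9 / 2 := by
  have hr : cfRight bar4_3_bar1312 0 = cfVal seq3then1312 := by
    rw [cfRight]
    congr 1
    funext n
    rcases n with _ | n
    · rfl
    · rw [bar4_3_bar1312, if_neg (by omega), if_neg (by omega), seq3then1312, if_neg (by omega),
        pat1312]
      congr 1
      omega
  have hl : cfLeft bar4_3_bar1312 (-1) = cfVal fun _ => 4 := by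
    rw [cfLeft]
    congr 1
    funext n
    exact bar_of_neg (by omega)
  have h := cfLeft_eq one_le_bar (-1)
  rw [lambda0_shiftZ one_le_bar, ← cfVal_four_add_cf01_seq3then1312, cf01, ← hr, ← hl, h]
  norm_num
  ring

theorem lambda0_bar_two : lambda0 (shiftZ 2 bar4_3_bar1312) = 9 / 2 := by
  have hr : cfRight bar4_3_bar1312 (2 + 1) = cfVal pat1213 := by
    rw [cfRight]
    congr 1
    funext n
    rw [bar4_3_bar1312, if_neg (by omega), if_neg (by omega), pat1213]
    have h : n % 4 = 0 ∨ n % 4 = 1 ∨ n % 4 = 2 ∨ n % 4 = 3 := by omega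
    rcases h with h | h | h | h
    · rw [h, show ((2 + 1 + n - 1 : ℤ) % 4) = 2 by omega]; rfl
    · rw [h, show ((2 + 1 + n - 1 : ℤ) % 4) = 3 by omega]; rfl
    · rw [h, show ((2 + 1 + n - 1 : ℤ) % 4) = 0 by omega]; rfl
    · rw [h, show ((2 + 1 + n - 1 : ℤ) % 4) = 1 by omega]; rfl
  have hl : cfLeft bar4_3_bar1312 2 = cfVal seq313bar4 := by
    rw [cfLeft]
    congr 1
    funext n
    rcases n with _ | _ | _ | n
    · rfl
    · rfl
    · rfl
    · rw [bar_of_neg (by omega)]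
      simp [seq313bar4]
  have h := cfLeft_eq one_le_bar 2
  rw [lambda0_shiftZ one_le_bar, ← cfVal_seq313bar4_add_cf01_pat1213, cf01, ← hr, ← hl, h]
  ring

theorem lambda0_shiftZ_le_of_four {α : ℤ → ℕ} (hα : ∀ i, 1 ≤ α i) {i : ℤ} (h₀ : α i = 4)
    (h₁ : α (i + 1) = 4) (h₂ : α (i - 1) = 4) : lambda0 (shiftZ i α) ≤ 9 / 2 := by
  have hr := one_div_cfRight_le hα (i + 1)
  have hl := one_div_cfLeft_le hα (i - 1)
  rw [h₁] at hr
  rw [h₂] at hl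
  rw [lambda0_shiftZ hα, h₀]
  push_cast at *
  linarith

theorem one_div_one_add_one_div_le {x y : ℝ} (hx : 0 < x) (hy : x = 1 + 1 / y) (hy₀ : 0 < y)
    (hy₃ : y ≤ 3) : 1 / x ≤ 3 / 4 := by
  have : 1 / 3 ≤ 1 / y := one_div_le_one_div_of_le hy₀ hy₃
  rw [div_le_iff₀ hx]
  linarith

theorem lambda0_shiftZ_le_of_three {α : ℤ → ℕ} (hα : ∀ i, 1 ≤ α i) {i : ℤ} (h₀ : α i = 3)
    (h₁ : α (i + 1) = 1) (h₂ : α (i - 1) = 1) (h₃ : α (i + 1 + 1) = 2) (h₄ : α (i - 1 - 1) = 2) :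
    lambda0 (shiftZ i α) ≤ 9 / 2 := by
  have hr : 1 / cfRight α (i + 1) ≤ 3 / 4 := by
    refine one_div_one_add_one_div_le (y := cfRight α (i + 1 + 1))
      (one_pos.trans_le (one_le_cfVal fun _ => hα _)) ?_
      (one_pos.trans_le (one_le_cfVal fun _ => hα _)) ?_
    · rw [cfRight_eq hα, h₁, Nat.cast_one]
    · rw [cfRight_eq hα, h₃]
      push_cast
      linarith [one_div_cfRight_le_one hα (i + 1 + 1 + 1)]
  have hl : 1 / cfLeft α (i - 1) ≤ 3 / 4 := by
    refine one_div_one_add_one_div_le (y := cfLeft α (i - 1 - 1))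
      (one_pos.trans_le (one_le_cfVal fun _ => hα _)) ?_
      (one_pos.trans_le (one_le_cfVal fun _ => hα _)) ?_
    · rw [cfLeft_eq hα, h₂, Nat.cast_one]
    · rw [cfLeft_eq hα, h₄]
      push_cast
      linarith [one_div_cfLeft_le_one hα (i - 1 - 1 - 1)]
  rw [lambda0_shiftZ hα, h₀]
  push_cast
  linarith

theorem lambda0_bar_le (i : ℤ) : lambda0 (shiftZ i bar4_3_bar1312) ≤ 9 / 2 := by
  rcases lt_trichotomy i 0 with hi | rfl | hi
  · rcases eq_or_ne i (-1) with rfl | h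
    · exact lambda0_bar_neg_one.le
    · exact lambda0_shiftZ_le_of_four one_le_bar (bar_of_neg hi) (bar_of_neg (by omega))
        (bar_of_neg (by omega))
  · have hl := one_div_cfLeft_le one_le_bar (0 - 1)
    have hr := one_div_cfRight_le_one one_le_bar (0 + 1)
    rw [bar_of_neg (by norm_num)] at hl
    rw [lambda0_shiftZ one_le_bar, bar_zero]
    push_cast at *
    linarith
  · have hb := bar_of_pos hi
    have hle := lambda0_shiftZ_le one_le_bar i
    have h : i % 4 = 0 ∨ i % 4 = 1 ∨ i % 4 = 3 ∨ i = 2 ∨ (i % 4 = 2 ∧ 6 ≤ i) := by omega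
    rcases h with h | h | h | rfl | ⟨h, h₆⟩
    · rw [show bar4_3_bar1312 i = 2 by rw [hb, h]; rfl] at hle
      push_cast at hle
      linarith
    · rw [show bar4_3_bar1312 i = 1 by rw [hb, h]; rfl] at hle
      push_cast at hle
      linarith
    · rw [show bar4_3_bar1312 i = 1 by rw [hb, h]; rfl] at hle
      push_cast at hle
      linarith
    · exact lambda0_bar_two.le
    · refine lambda0_shiftZ_le_of_three one_le_bar ?_ ?_ ?_ ?_ ?_
      · rw [hb, h]; rfl
      · rw [bar_of_pos (by omega), show (i + 1) % 4 = 3 by omega]; rfl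
      · rw [bar_of_pos (by omega), show (i - 1) % 4 = 1 by omega]; rfl
      · rw [bar_of_pos (by omega), show (i + 1 + 1) % 4 = 0 by omega]; rfl
      · rw [bar_of_pos (by omega), show (i - 1 - 1) % 4 = 0 by omega]; rfl

theorem markovValue_bar : markovValue bar4_3_bar1312 = 9 / 2 := by
  refine le_antisymm (ciSup_le lambda0_bar_le) ?_
  rw [← lambda0_bar_neg_one]
  exact le_ciSup (f := fun n => lambda0 (shiftZ n bar4_3_bar1312))
    ⟨9 / 2, Set.forall_mem_range.2 lambda0_bar_le⟩ (-1)

/-- The radius `R` window of `α` around `i` occurs, up to reversal, in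
`overline{4} 3 overline{1,3,1,2}`. -/
def WindowInBar (R : ℤ) (α : ℤ → ℕ) (i : ℤ) : Prop :=
  ∃ c, (∀ j, |j| ≤ R → α (i + j) = bar4_3_bar1312 (c + j)) ∨
    ∀ j, |j| ≤ R → α (i + j) = bar4_3_bar1312 (c - j)

theorem exists_radius_lambda0_bounds {ε : ℝ} (hε : 0 < ε) :
    ∃ R : ℤ, 0 ≤ R ∧ ∀ α : ℤ → ℕ, (∀ i, 1 ≤ α i) → ∀ i,
      (WindowInBar R α i → lambda0 (shiftZ i α) ≤ 9 / 2 + ε) ∧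
      ((∀ j, |j| ≤ R → α (i + j) = bar4_3_bar1312 (-1 + j)) →
        9 / 2 - ε ≤ lambda0 (shiftZ i α)) := by
  obtain ⟨R, hR₀, hR⟩ := exists_radius_abs_lambda0_sub_le hε
  refine ⟨R, hR₀, fun α hα i => ⟨?_, fun h => ?_⟩⟩
  · rintro ⟨c, h | h⟩
    · have := (abs_le.1 (hR α _ hα one_le_bar i c h)).2
      linarith [lambda0_bar_le c]
    · have := (abs_le.1 (hR α (fun j => bar4_3_bar1312 (-j)) hα (fun j => one_le_bar _) i (-c)
        fun j hj => by rw [h j hj]; congr 1; ring)).2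
      rw [lambda0_shiftZ_comp_neg one_le_bar] at this
      linarith [lambda0_bar_le (- -c)]
  · have := (abs_le.1 (hR α _ hα one_le_bar i (-1) h)).1
    linarith [lambda0_bar_neg_one]

/-! ### The periodic sequences -/

theorem length_periodWord (n : ℕ) : (periodWord n).length = 5 * n + 5 := by
  simp [periodWord]
  omega

theorem getD_periodWord_add (n m : ℕ) :
    (periodWord n).getD (n + m + 1) 0 =
      (((List.range (4 * n)).map fun i => [1, 3, 1, 2].getD (i % 4) 0) ++
        [1, 3, 1, 3]).getD m 0 := by
  rw [periodWord, List.append_assoc, List.append_assoc,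
    List.getD_append_right _ _ _ _ (by simp; omega), List.length_replicate,
    show n + m + 1 - n = m + 1 by omega]
  rfl

theorem getD_periodWord (n r : ℕ) (hr : r < 5 * n + 4) :
    (periodWord n).getD r 0 = bar4_3_bar1312 (r - n) := by
  have hp : ∀ m : ℕ, [1, 3, 1, 2].getD (m % 4) 0 = bar4_3_bar1312 (m + 1) := fun m => by
    rw [bar4_3_bar1312, if_neg (by omega), if_neg (by omega)]
    congr 1
    omega
  rcases lt_trichotomy r n with h | rfl | h
  · rw [bar_of_neg (by omega)]
    simp [periodWord, List.getElem?_append, h]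
  · simp [periodWord, bar_zero]
  obtain ⟨m, rfl⟩ := Nat.exists_eq_add_of_lt h
  rw [show ((n + m + 1 : ℕ) : ℤ) - n = m + 1 by push_cast; ring, ← hp, getD_periodWord_add]
  rcases lt_or_ge m (4 * n) with hm | hm
  · rw [List.getD_append _ _ _ _ (by simpa using hm)]
    simp [hm]
  · obtain ⟨t, rfl⟩ := Nat.exists_eq_add_of_le hm
    have ht : t < 3 := by omega
    rw [List.getD_append_right _ _ _ _ (by simp), List.length_map, List.length_range,
      Nat.add_sub_cancel_left, Nat.mul_add_mod]
    interval_cases t <;> rfl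

theorem getD_periodWord_last (n : ℕ) : (periodWord n).getD (5 * n + 4) 0 = 3 := by
  rw [show 5 * n + 4 = n + (4 * n + 3) + 1 by ring, getD_periodWord_add,
    List.getD_append_right _ _ _ _ (by simp), List.length_map, List.length_range,
    Nat.add_sub_cancel_left]
  rfl

theorem periodicSeqZ_of_mem {w : List ℕ} {i : ℤ} (hi : 0 ≤ i) (hw : i < w.length) :
    periodicSeqZ w i = w.getD i.toNat 0 := by
  rw [periodicSeqZ, Int.emod_eq_of_lt hi hw]

theorem periodicSeqZ_add_length (w : List ℕ) (i : ℤ) :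
    periodicSeqZ w (i + w.length) = periodicSeqZ w i := by
  rw [periodicSeqZ, periodicSeqZ, Int.add_emod_right]

theorem periodicSeqZ_emod (w : List ℕ) (i j : ℤ) :
    periodicSeqZ w (i % w.length + j) = periodicSeqZ w (i + j) := by
  rw [periodicSeqZ, periodicSeqZ, Int.emod_add_emod]

theorem periodicSeqZ_periodWord {n : ℕ} {i : ℤ} (hi : 0 ≤ i) (hin : i ≤ 5 * n + 3) :
    periodicSeqZ (periodWord n) i = bar4_3_bar1312 (i - n) := by
  rw [periodicSeqZ_of_mem hi (by rw [length_periodWord]; push_cast; omega),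
    getD_periodWord n _ (by omega), Int.toNat_of_nonneg hi]

/-- The reversal symmetry of the word `3 (1312)ⁿ 1313`. -/
theorem bar_reverse {n : ℕ} {i : ℤ} (hi : 0 < i) (hin : i < 4 * n + 4) :
    bar4_3_bar1312 (4 * n + 4 - i) = bar4_3_bar1312 i := by
  rw [bar_of_pos hi, bar_of_pos (by omega)]
  have h : i % 4 = 0 ∨ i % 4 = 1 ∨ i % 4 = 2 ∨ i % 4 = 3 := by omega
  rcases h with h | h | h | h
  · rw [h, show (4 * n + 4 - i) % 4 = 0 by omega]
  · rw [h, show (4 * n + 4 - i) % 4 = 3 by omega]; rfl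
  · rw [h, show (4 * n + 4 - i) % 4 = 2 by omega]
  · rw [h, show (4 * n + 4 - i) % 4 = 1 by omega]; rfl

theorem periodicSeqZ_periodWord_reverse {n : ℕ} {i : ℤ} (hi : -(4 * n + 4) ≤ i)
    (hin : i ≤ n - 1) : periodicSeqZ (periodWord n) i = bar4_3_bar1312 (-1 - i) := by
  rcases le_or_gt 0 i with h₀ | h₀
  · rw [periodicSeqZ_periodWord h₀ (by omega), bar_of_neg (by omega), bar_of_neg (by omega)]
  rw [← periodicSeqZ_add_length, length_periodWord]
  rcases eq_or_ne i (-1) with rfl | h₁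
  · rw [periodicSeqZ_of_mem (by omega) (by rw [length_periodWord]; omega),
      show (-1 + ((5 * n + 5 : ℕ) : ℤ)).toNat = 5 * n + 4 by omega, getD_periodWord_last]
    rfl
  · rw [periodicSeqZ_periodWord (by omega) (by push_cast; omega),
      ← bar_reverse (n := n) (i := -1 - i) (by omega) (by omega)]
    congr 1
    push_cast
    ring

theorem one_le_periodicSeqZ_periodWord (n : ℕ) (i : ℤ) :
    1 ≤ periodicSeqZ (periodWord n) i := by
  rw [← add_zero i, ← periodicSeqZ_emod, add_zero, length_periodWord]
  have h₀ := Int.emod_nonneg i (b := ((5 * n + 5 : ℕ) : ℤ)) (by omega)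
  have h₁ := Int.emod_lt_of_pos i (b := ((5 * n + 5 : ℕ) : ℤ)) (by omega)
  rcases eq_or_ne (i % ((5 * n + 5 : ℕ) : ℤ)) (5 * n + 4) with h | h
  · rw [h, periodicSeqZ_of_mem (by omega) (by rw [length_periodWord]; omega),
      show (5 * n + 4 : ℤ).toNat = 5 * n + 4 by omega, getD_periodWord_last]
    norm_num
  · rw [periodicSeqZ_periodWord h₀ (by omega)]
    exact one_le_bar _

theorem windowInBar_periodWord {n : ℕ} {R : ℤ} (hR : 2 * R + 2 ≤ n) (i : ℤ) :
    WindowInBar R (periodicSeqZ (periodWord n)) i := by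
  have h₀ := Int.emod_nonneg i (b := ((5 * n + 5 : ℕ) : ℤ)) (by omega)
  have h₁ := Int.emod_lt_of_pos i (b := ((5 * n + 5 : ℕ) : ℤ)) (by omega)
  have hper := fun j => periodicSeqZ_emod (periodWord n) i j
  rw [length_periodWord] at hper
  set r := i % ((5 * n + 5 : ℕ) : ℤ)
  rcases lt_or_ge r R with h | h
  · refine ⟨-1 - r, Or.inr fun j hj => ?_⟩
    rw [abs_le] at hj
    rw [← hper, periodicSeqZ_periodWord_reverse (by omega) (by omega), sub_sub]
  rcases le_or_gt r (3 * n) with h' | h'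
  · refine ⟨r - n, Or.inl fun j hj => ?_⟩
    rw [abs_le] at hj
    rw [← hper, periodicSeqZ_periodWord (by omega) (by omega)]
    congr 1
    ring
  · refine ⟨5 * n + 4 - r, Or.inr fun j hj => ?_⟩
    rw [abs_le] at hj
    rw [← hper, ← sub_add_cancel (r + j) ((periodWord n).length : ℤ), periodicSeqZ_add_length,
      length_periodWord, periodicSeqZ_periodWord_reverse (by omega) (by omega)]
    congr 1
    push_cast
    ring

theorem tendsto_markovValue_periodWord :
    Tendsto (fun n : ℕ => markovValue (periodicSeqZ (periodWord n))) atTop (nhds (9 / 2)) := by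
  refine Metric.tendsto_atTop.2 fun ε hε => ?_
  obtain ⟨R, hR₀, hR⟩ := exists_radius_lambda0_bounds (half_pos hε)
  refine ⟨(2 * R + 2).toNat, fun n hn => ?_⟩
  have hn' : 2 * R + 2 ≤ n := by omega
  have hα := one_le_periodicSeqZ_periodWord n
  have hle : ∀ i, lambda0 (shiftZ i (periodicSeqZ (periodWord n))) ≤ 9 / 2 + ε / 2 :=
    fun i => (hR _ hα i).1 (windowInBar_periodWord hn' i)
  have hge := (hR _ hα (n - 1)).2 fun j hj => by
    rw [abs_le] at hj
    rw [periodicSeqZ_periodWord (by omega) (by omega)]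
    congr 1
    ring
  have h₁ : markovValue (periodicSeqZ (periodWord n)) ≤ 9 / 2 + ε / 2 := ciSup_le hle
  have h₂ : _ ≤ markovValue (periodicSeqZ (periodWord n)) :=
    le_ciSup (f := fun i => lambda0 (shiftZ i (periodicSeqZ (periodWord n))))
      ⟨_, Set.forall_mem_range.2 hle⟩ (n - 1)
  rw [Real.dist_eq, abs_lt]
  constructor <;> linarith

/-! ### A sequence with Lagrange value `9/2` -/

/-- A sequence with `3` at the powers of two, whose gaps between consecutive powers of two are
filled alternately with `4`'s and with a piece of the periodic sequence `overline{1,3,1,2}`. -/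
def dyadicSeq : ℤ → ℕ := fun i =>
  if i ≤ 0 then 1
  else if i.toNat = 2 ^ Nat.log 2 i.toNat then 3
  else if Even (Nat.log 2 i.toNat) then [2, 1, 3, 1].getD (i % 4).toNat 0
  else 4

theorem one_le_dyadicSeq (i : ℤ) : 1 ≤ dyadicSeq i := by
  unfold dyadicSeq
  split_ifs
  · norm_num
  · norm_num
  · exact getD_mod_four_pos (by norm_num) (by norm_num) (by norm_num) (by norm_num) (by omega)
  · norm_num

theorem dyadicSeq_le (i : ℤ) : dyadicSeq i ≤ 4 := by
  unfold dyadicSeq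
  split_ifs
  · norm_num
  · norm_num
  · have : (i % 4).toNat < 4 := by omega
    interval_cases (i % 4).toNat <;> simp
  · norm_num

theorem dyadicSeq_two_pow (k : ℕ) : dyadicSeq (2 ^ k) = 3 := by
  have h : ((2 : ℤ) ^ k).toNat = 2 ^ k := by
    rw [← Int.toNat_natCast (2 ^ k)]
    push_cast
    rfl
  have h₀ : ¬ (2 : ℤ) ^ k ≤ 0 := not_le.2 (by positivity)
  rw [dyadicSeq, if_neg h₀, h, if_pos (by rw [Nat.log_pow (by norm_num)])]

theorem dyadicSeq_gap {k : ℕ} {i : ℤ} (h₁ : 2 ^ k < i) (h₂ : i < 2 ^ (k + 1)) :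
    dyadicSeq i = if Even k then [2, 1, 3, 1].getD (i % 4).toNat 0 else 4 := by
  have h₀ : (0 : ℤ) < 2 ^ k := by positivity
  lift i to ℕ using by omega
  have h₁' : 2 ^ k < i := by exact_mod_cast h₁
  have hlog : Nat.log 2 i = k :=
    (Nat.log_eq_iff (Or.inr ⟨by norm_num, by omega⟩)).2 ⟨h₁'.le, by exact_mod_cast h₂⟩
  rw [dyadicSeq, if_neg (by omega), Int.toNat_natCast, hlog, if_neg (by omega)]

/-- Around `2 ^ (k + 1)`, the sequence `dyadicSeq` agrees with `overline{4} 3 overline{1,3,1,2}` or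
with its reversal, according to the parity of `k`. -/
theorem dyadicSeq_near_two_pow {k : ℕ} (hk : 1 ≤ k) {i : ℤ} (h₁ : 2 ^ k < i)
    (h₂ : i < 2 ^ (k + 2)) :
    dyadicSeq i =
      bar4_3_bar1312 (if Even k then 2 ^ (k + 1) - i else i - 2 ^ (k + 1)) := by
  have h4 : (4 : ℤ) ∣ 2 ^ (k + 1) := by
    obtain ⟨m, rfl⟩ := Nat.exists_eq_add_of_le' hk
    exact ⟨2 ^ m, by ring⟩
  rcases lt_trichotomy i (2 ^ (k + 1)) with h | rfl | h
  · rw [dyadicSeq_gap h₁ h]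
    split_ifs with he
    · rw [bar_of_pos (by omega)]
      have hm : i % 4 = 0 ∨ i % 4 = 1 ∨ i % 4 = 2 ∨ i % 4 = 3 := by omega
      rcases hm with hm | hm | hm | hm
      · rw [hm, show (2 ^ (k + 1) - i) % 4 = 0 by omega]
      · rw [hm, show (2 ^ (k + 1) - i) % 4 = 3 by omega]; rfl
      · rw [hm, show (2 ^ (k + 1) - i) % 4 = 2 by omega]
      · rw [hm, show (2 ^ (k + 1) - i) % 4 = 1 by omega]; rfl
    · rw [bar_of_neg (by omega)]
  · rw [dyadicSeq_two_pow]
    simp [bar_zero]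
  · rw [dyadicSeq_gap h h₂]
    by_cases he : Even k
    · rw [if_neg (by simpa [Nat.even_add_one] using he), if_pos he, bar_of_neg (by omega)]
    · rw [if_pos (Nat.even_add_one.2 he), if_neg he, bar_of_pos (by omega),
        show (i - 2 ^ (k + 1)) % 4 = i % 4 by omega]

theorem windowInBar_dyadicSeq_of_near {k : ℕ} (hk : 1 ≤ k) {R i : ℤ} (h₁ : 2 ^ k < i - R)
    (h₂ : i + R < 2 ^ (k + 2)) : WindowInBar R dyadicSeq i := by
  have h := fun j (hj : |j| ≤ R) => dyadicSeq_near_two_pow (i := i + j) hk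
    (by rw [abs_le] at hj; omega) (by rw [abs_le] at hj; omega)
  by_cases he : Even k
  · refine ⟨2 ^ (k + 1) - i, Or.inr fun j hj => ?_⟩
    rw [h j hj, if_pos he, sub_sub]
  · refine ⟨i - 2 ^ (k + 1), Or.inl fun j hj => ?_⟩
    rw [h j hj, if_neg he, add_sub_right_comm]

theorem eventually_windowInBar_dyadicSeq {R : ℤ} (hR : 0 ≤ R) :
    ∀ᶠ n : ℕ in atTop, WindowInBar R dyadicSeq n := by
  obtain ⟨K, hK⟩ := pow_unbounded_of_one_lt R (show (1 : ℤ) < 2 by norm_num)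
  filter_upwards [eventually_ge_atTop (2 ^ (K + 2))] with n hn
  have hn₀ : n ≠ 0 := by
    have : 0 < 2 ^ (K + 2) := by positivity
    omega
  obtain ⟨k, hk⟩ : ∃ k, Nat.log 2 n = k + 2 := by
    have := (Nat.le_log_iff_pow_le (by norm_num) hn₀).2 hn
    exact ⟨Nat.log 2 n - 2, by omega⟩
  have hKk : K ≤ k := by
    have := (Nat.le_log_iff_pow_le (by norm_num) hn₀).2 hn
    omega
  have h₁ : (2 : ℤ) ^ (k + 2) ≤ n := by
    rw [← hk]
    exact_mod_cast Nat.pow_log_le_self 2 hn₀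
  have h₂ : (n : ℤ) < 2 ^ (k + 3) := by
    have := Nat.lt_pow_succ_log_self (b := 2) (by norm_num) n
    rw [hk] at this
    exact_mod_cast this
  have h₃ : R < 2 ^ k := hK.trans_le (pow_le_pow_right₀ (by norm_num) hKk)
  have e₁ : (2 : ℤ) ^ (k + 1) = 2 * 2 ^ k := by ring
  have e₂ : (2 : ℤ) ^ (k + 2) = 4 * 2 ^ k := by ring
  have e₃ : (2 : ℤ) ^ (k + 3) = 8 * 2 ^ k := by ring
  have e₄ : (2 : ℤ) ^ (k + 4) = 16 * 2 ^ k := by ring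
  rcases lt_or_ge (n : ℤ) (6 * 2 ^ k) with h | h
  · exact windowInBar_dyadicSeq_of_near (k := k + 1) (by omega) (by omega)
      (by rw [show k + 1 + 2 = k + 3 from rfl]; omega)
  · exact windowInBar_dyadicSeq_of_near (k := k + 2) (by omega) (by omega)
      (by rw [show k + 2 + 2 = k + 4 from rfl]; omega)

theorem frequently_dyadicSeq_eq_bar (R : ℤ) :
    ∃ᶠ n : ℕ in atTop, ∀ j, |j| ≤ R → dyadicSeq (n + j) = bar4_3_bar1312 (-1 + j) := by
  refine frequently_atTop.2 fun N => ?_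
  obtain ⟨K, hK⟩ := pow_unbounded_of_one_lt (max (N : ℤ) (R + 1)) (show (1 : ℤ) < 2 by norm_num)
  have hK' : (2 : ℤ) ^ K ≤ 2 ^ (2 * K + 1) := pow_le_pow_right₀ (by norm_num) (by omega)
  have hN := (le_max_left (N : ℤ) (R + 1)).trans_lt hK
  have hR := (le_max_right (N : ℤ) (R + 1)).trans_lt hK
  have e₁ : (2 : ℤ) ^ (2 * K + 1 + 1) = 2 * 2 ^ (2 * K + 1) := by ring
  have e₂ : (2 : ℤ) ^ (2 * K + 1 + 2) = 4 * 2 ^ (2 * K + 1) := by ring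
  refine ⟨(2 ^ (2 * K + 1 + 1) - 1 : ℤ).toNat, by omega, fun j hj => ?_⟩
  rw [abs_le] at hj
  rw [Int.toNat_of_nonneg (by omega), dyadicSeq_near_two_pow (k := 2 * K + 1) (by omega)
    (by omega) (by omega), if_neg (by simp)]
  congr 1
  ring

theorem lagrangeValue_dyadicSeq : lagrangeValue dyadicSeq = 9 / 2 := by
  have hle : ∀ n : ℕ, lambda0 (shiftZ n dyadicSeq) ≤ 6 := fun n => by
    have h₁ := lambda0_shiftZ_le one_le_dyadicSeq n
    have h₂ : (dyadicSeq n : ℝ) ≤ 4 := mod_cast dyadicSeq_le n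
    linarith
  have hbdd : IsBoundedUnder (· ≤ ·) atTop fun n : ℕ => lambda0 (shiftZ n dyadicSeq) :=
    isBoundedUnder_of ⟨6, hle⟩
  have hcobdd : IsCoboundedUnder (· ≤ ·) atTop fun n : ℕ => lambda0 (shiftZ n dyadicSeq) :=
    (isBoundedUnder_of ⟨0, fun n : ℕ => lambda0_shiftZ_nonneg one_le_dyadicSeq n⟩ :
        IsBoundedUnder (· ≥ ·) atTop fun n : ℕ => lambda0 (shiftZ n dyadicSeq)).isCoboundedUnder_le
  refine le_antisymm (le_of_forall_pos_le_add fun ε hε => ?_)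
    (le_of_forall_pos_le_add fun ε hε => ?_)
  all_goals obtain ⟨R, hR₀, hR⟩ := exists_radius_lambda0_bounds hε
  · exact limsup_le_of_le hcobdd ((eventually_windowInBar_dyadicSeq hR₀).mono fun n hn =>
      (hR _ one_le_dyadicSeq n).1 hn)
  · rw [← sub_le_iff_le_add]
    exact le_limsup_of_frequently_le ((frequently_dyadicSeq_eq_bar R).mono fun n hn =>
      (hR _ one_le_dyadicSeq n).2 hn) hbdd

/-- `[4; overline{4}] + [0; 3, overline{1,3,1,2}] = 9/2 = [3; 1, 3, overline{4}] + [0; overline{1,2,1,3}]`.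
In particular `9/2 = m(overline{4} 3 overline{1,3,1,2}) = lim_n m(overline{4ⁿ 3 (1312)ⁿ 1313})`
belongs to `L ∩ ℚ`. -/
theorem nine_halves_mem_Lagrange :
    cfVal (fun _ => 4) + cf01 seq3then1312 = 9 / 2 ∧
    cfVal seq313bar4 + cf01 pat1213 = 9 / 2 ∧
    markovValue bar4_3_bar1312 = 9 / 2 ∧
    Filter.Tendsto (fun n : ℕ => markovValue (periodicSeqZ (periodWord n)))
      Filter.atTop (nhds (9 / 2 : ℝ)) ∧
    (9 / 2 : ℝ) ∈ LagrangeSpectrum ∧ (9 / 2 : ℝ) ∈ Set.range ((↑) : ℚ → ℝ) := by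
  exact ⟨cfVal_four_add_cf01_seq3then1312, cfVal_seq313bar4_add_cf01_pat1213, markovValue_bar,
    tendsto_markovValue_periodWord, ⟨dyadicSeq, one_le_dyadicSeq, lagrangeValue_dyadicSeq⟩,
    ⟨9 / 2, by norm_num⟩⟩
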